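/- For every real constant C, there exists a natural number n₀ such that for all n ≥ n₀ and all functions p, q : Fin n → ℤ satisfying the decodability property, the cardinality of the sumset {p i + q j : i, j ∈ Fin n} is at least C·n. Consequently, the recovery threshold of every Rook Code for batch matrix multiplication of n pairs of matrices, which equals the minimum of |P+Q| over all decodable pairs (p,q), is superlinear in n. -/

import Mathlib

/-- The decodability property for Rook Codes: `p k + q k = p i + q j` iff `i = k` and `j = k`. -/
def Decodable' (n : ℕ) (p q : Fin n → ℤ) : Prop :=
  ∀ i j k : Fin n, p k + q k = p i + q j ↔ (i = k ∧ j = k)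

/-- The sumset `{p i + q j : i, j ∈ Fin n}` as a finset of integers. -/
def sumset (n : ℕ) (p q : Fin n → ℤ) : Finset ℤ :=
  Finset.image (fun ij : Fin n × Fin n => p ij.1 + q ij.2) Finset.univ

open Finset SimpleGraph TripartiteFromTriangles
open scoped Pointwise

namespace Decodable'

section Pluennecke

variable {G : Type*} [AddCommGroup G] [DecidableEq G]

lemma card_nsmul_le {A B : Finset G} {n : ℕ} {K : ℝ} (hn : 0 < n) (hB : #B = n)
    (hAB : (#(A + B) : ℝ) ≤ K * n) (m : ℕ) : (#(m • A) : ℝ) ≤ K ^ m * n := by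
  have hBne : B.Nonempty := card_pos.1 (hB ▸ hn)
  have hn' : (0 : ℝ) < n := by exact_mod_cast hn
  have h : (#(m • A) : ℝ) ≤ (#(B + A) / #B : ℝ) ^ m * #B := by
    have := (NNRat.cast_le (K := ℝ)).2 (pluennecke_ruzsa_inequality_nsmul_add hBne A m)
    push_cast at this
    exact this
  rw [hB, add_comm B A] at h
  refine h.trans ?_
  gcongr
  rwa [div_le_iff₀ hn']

lemma card_two_nsmul_add_le {A B : Finset G} {n : ℕ} {K : ℝ} (hn : 0 < n) (hA : #A = n)
    (hB : #B = n) (hAB : (#(A + B) : ℝ) ≤ K * n) : (#(2 • A + B) : ℝ) ≤ K ^ 4 * n := by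
  have hn' : (0 : ℝ) < n := by exact_mod_cast hn
  have hK : 0 ≤ K := nonneg_of_mul_nonneg_left ((Nat.cast_nonneg _).trans hAB) hn'
  have h : (#(2 • A + B) : ℝ) * n ≤ #(3 • A) * #(A + B) := by
    have := ruzsa_triangle_inequality_add_add_add (2 • A) A B
    rw [← succ_nsmul, hA] at this
    exact_mod_cast this
  refine le_of_mul_le_mul_right ?_ hn'
  calc _ ≤ (#(3 • A) : ℝ) * #(A + B) := h
    _ ≤ (K ^ 3 * n) * (K * n) := by
      gcongr
      exact card_nsmul_le hn hB hAB 3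
    _ = _ := by ring

end Pluennecke

/-- Triangle removal for a tripartite graph on at most `M * n` vertices with exactly `n ^ 2`
triangles, which are edge-disjoint. -/
lemma triangleRemovalBound_mul_le_one_of_card_eq_sq {α β γ : Type*} [Fintype α] [Fintype β]
    [Fintype γ] {t : Finset (α × β × γ)} [ExplicitDisjoint t] [NoAccidental t] {n : ℕ} {M : ℝ}
    (ht : #t = n ^ 2) (hn : 0 < n) (hM : 0 < M) (hα : n ≤ Fintype.card α)
    (hcard : (Fintype.card α + Fintype.card β + Fintype.card γ : ℝ) ≤ M * n) :
    triangleRemovalBound (M ^ 2)⁻¹ * n ≤ 1 := by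
  classical
  have hn' : (0 : ℝ) < n := by exact_mod_cast hn
  have hα' : (n : ℝ) ≤ Fintype.card α := by exact_mod_cast hα
  have hfar : (graph t).FarFromTriangleFree (M ^ 2)⁻¹ := by
    refine farFromTriangleFree _ ?_
    rw [ht, inv_mul_le_iff₀ (by positivity)]
    push_cast
    rw [← mul_pow]
    gcongr
  have hcount := hfar.le_card_cliqueFinset
  rw [card_triangles, ht, Fintype.card_sum, Fintype.card_sum] at hcount
  push_cast at hcount
  refine le_of_mul_le_mul_right ?_ (pow_pos hn' 2)
  calc _ = triangleRemovalBound (M ^ 2)⁻¹ * (n : ℝ) ^ 3 := by ring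
    _ ≤ _ := by
      gcongr
      exact hα'.trans (le_add_of_nonneg_right (by positivity))
    _ ≤ _ := hcount
    _ = _ := (one_mul _).symm

variable {n : ℕ} {p q : Fin n → ℤ}

lemma injective_left (h : Decodable' n p q) : Function.Injective p := fun i k hik ↦
  ((h i k k).1 (by rw [hik])).1

lemma injective_right (h : Decodable' n p q) : Function.Injective q := fun j k hjk ↦
  ((h k j k).1 (by rw [hjk])).2

lemma injective_add (h : Decodable' n p q) : Function.Injective fun k ↦ p k + q k :=
  fun i k hik ↦ ((h i i k).1 hik.symm).1

lemma sumset_eq_add : sumset n p q = univ.image p + univ.image q := by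
  ext x
  simp [sumset, mem_add]

/-- The triples `(p i, p i + p k, p i + p k + q k)`, as elements of `P × 2P × (2P + Q)`. -/
def triangleIndices (p q : Fin n → ℤ) :
    Finset (↥(univ.image p) × ↥(2 • univ.image p) × ↥(2 • univ.image p + univ.image q)) :=
  univ.image fun ik : Fin n × Fin n ↦
    have hp (i : Fin n) : p i ∈ univ.image p := mem_image_of_mem p (mem_univ i)
    have hpp : p ik.1 + p ik.2 ∈ 2 • univ.image p := two_nsmul (univ.image p) ▸
      add_mem_add (hp ik.1) (hp ik.2)
    (⟨p ik.1, hp ik.1⟩, ⟨p ik.1 + p ik.2, hpp⟩,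
      ⟨p ik.1 + p ik.2 + q ik.2, add_mem_add hpp (mem_image_of_mem q (mem_univ ik.2))⟩)

lemma exists_of_mem_triangleIndices
    {x : ↥(univ.image p) × ↥(2 • univ.image p) × ↥(2 • univ.image p + univ.image q)}
    (hx : x ∈ triangleIndices p q) :
    ∃ k, (x.2.1 : ℤ) = x.1 + p k ∧ (x.2.2 : ℤ) = x.2.1 + q k := by
  obtain ⟨⟨i, k⟩, -, rfl⟩ := mem_image.1 hx
  exact ⟨k, rfl, rfl⟩

lemma card_triangleIndices (h : Decodable' n p q) : #(triangleIndices p q) = n ^ 2 := by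
  rw [triangleIndices, card_image_of_injective]
  · simp [sq]
  · rintro ⟨i, k⟩ ⟨i', k'⟩ hik
    simp only [Prod.mk.injEq, Subtype.mk.injEq] at hik
    obtain rfl := h.injective_left hik.1
    obtain rfl := h.injective_left (add_left_cancel hik.2.1)
    rfl

lemma explicitDisjoint_triangleIndices (h : Decodable' n p q) :
    ExplicitDisjoint (triangleIndices p q) where
  inj₀ a b c a' h₁ h₂ := by
    obtain ⟨k, hk, hk'⟩ := exists_of_mem_triangleIndices h₁
    obtain ⟨l, hl, hl'⟩ := exists_of_mem_triangleIndices h₂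
    dsimp only at *
    obtain rfl : k = l := h.injective_right (by linarith)
    exact Subtype.ext (by linarith)
  inj₁ a b c b' h₁ h₂ := by
    obtain ⟨k, hk, hk'⟩ := exists_of_mem_triangleIndices h₁
    obtain ⟨l, hl, hl'⟩ := exists_of_mem_triangleIndices h₂
    dsimp only at *
    obtain rfl : k = l := h.injective_add (by dsimp only; linarith)
    exact Subtype.ext (by linarith)
  inj₂ a b c c' h₁ h₂ := by
    obtain ⟨k, hk, hk'⟩ := exists_of_mem_triangleIndices h₁
    obtain ⟨l, hl, hl'⟩ := exists_of_mem_triangleIndices h₂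
    dsimp only at *
    obtain rfl : k = l := h.injective_left (by linarith)
    exact Subtype.ext (by linarith)

lemma noAccidental_triangleIndices (h : Decodable' n p q) :
    NoAccidental (triangleIndices p q) where
  eq_or_eq_or_eq a a' b b' c c' ha hb hc := by
    obtain ⟨j, hj, hj'⟩ := exists_of_mem_triangleIndices ha
    obtain ⟨k, hk, hk'⟩ := exists_of_mem_triangleIndices hb
    obtain ⟨i, hi, hi'⟩ := exists_of_mem_triangleIndices hc
    dsimp only at *
    obtain ⟨rfl, rfl⟩ := (h i j k).1 (by linarith)
    exact .inl (Subtype.ext (by linarith))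

/-- If `|P + Q| ≤ K n`, the triangle removal lemma bounds `n`. -/
lemma triangleRemovalBound_mul_le_one (h : Decodable' n p q) (hn : 0 < n) {K : ℝ}
    (hK : (#(sumset n p q) : ℝ) ≤ K * n) :
    triangleRemovalBound ((1 + K ^ 2 + K ^ 4) ^ 2)⁻¹ * n ≤ 1 := by
  have := h.explicitDisjoint_triangleIndices
  have := h.noAccidental_triangleIndices
  rw [sumset_eq_add] at hK
  have hP : #(univ.image p) = n := by simp [card_image_of_injective _ h.injective_left]
  have hQ : #(univ.image q) = n := by simp [card_image_of_injective _ h.injective_right]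
  have hPP := card_nsmul_le hn hQ hK 2
  have hPPQ := card_two_nsmul_add_le hn hP hQ hK
  refine triangleRemovalBound_mul_le_one_of_card_eq_sq h.card_triangleIndices hn
    (by positivity) ?_ ?_
  · rw [Fintype.card_coe, hP]
  · simp only [Fintype.card_coe, hP]
    linarith

end Decodable'

/-- Every Rook Code for batch matrix multiplication has superlinear recovery threshold:
`|P+Q| = ω(n)` over all decodable pairs. -/
theorem stmt1 (C : ℝ) :
    ∃ n₀ : ℕ, ∀ n : ℕ, n₀ ≤ n → ∀ p q : Fin n → ℤ,
      Decodable' n p q →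
      C * n ≤ ((sumset n p q).card : ℝ) := by
  have hδ : 0 < triangleRemovalBound ((1 + C ^ 2 + C ^ 4) ^ 2)⁻¹ :=
    triangleRemovalBound_pos (by positivity)
  obtain ⟨n₀, hn₀⟩ := exists_nat_gt (triangleRemovalBound ((1 + C ^ 2 + C ^ 4) ^ 2)⁻¹)⁻¹
  refine ⟨n₀, fun n hn p q h ↦ ?_⟩
  by_contra! hC
  have hn' : (triangleRemovalBound ((1 + C ^ 2 + C ^ 4) ^ 2)⁻¹)⁻¹ < n :=
    hn₀.trans_le (by exact_mod_cast hn)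
  have hpos : 0 < n := by exact_mod_cast (inv_pos.2 hδ).trans hn'
  rw [inv_lt_iff_one_lt_mul₀' hδ] at hn'
  exact hn'.not_ge (h.triangleRemovalBound_mul_le_one hpos hC.le)
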